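/- Let X be a finite-dimensional real normed linear space of dimension at least 2 and let λ > 0. Then the rectangular modulus satisfies μ_X(λ) = max{λ + 2, 1 + 2λ}, i.e., sup{max{(λ² + t)/‖λ·u + t·v‖, (1 + λ²·t)/‖u + λ·t·v‖} : t > 0, u, v ∈ S_X, u ⊥_B v} = max{λ + 2, 1 + 2λ}, if and only if there exist unit vectors u, v ∈ X such that ‖t·u + (1−t)·v‖ = 1 for all t ∈ (0,1) and ‖u − v‖ = 2. -/

import Mathlib

/-- The elementary estimate behind the upper bound of the rectangular modulus. -/
theorem add_mul_div_le_add_two_mul {a b s N : ℝ} (ha : 0 < a) (hb : 0 < b)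
    (h1 : 1 ≤ N) (h2 : s - 1 ≤ N) : (a + b * s) / N ≤ a + 2 * b := by
  rw [div_le_iff₀ (by linarith)]
  rcases le_total s 2 with h | h
  · nlinarith
  · nlinarith [mul_le_mul_of_nonneg_left h2 (by positivity : 0 ≤ a + 2 * b)]

/-- The equality case of `add_mul_div_le_add_two_mul`. -/
theorem eq_two_and_eq_one_of_add_two_mul_le {a b s N : ℝ} (ha : 0 < a) (hb : 0 < b)
    (h1 : 1 ≤ N) (h2 : s - 1 ≤ N) (h : a + 2 * b ≤ (a + b * s) / N) : s = 2 ∧ N = 1 := by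
  rw [le_div_iff₀ (by linarith)] at h
  have hpos : 0 < a + 2 * b := by positivity
  have hs1 : 2 ≤ s := by
    have := mul_le_mul_of_nonneg_left h1 hpos.le
    by_contra! hc
    nlinarith
  have hs2 : s ≤ 2 := by
    have := mul_le_mul_of_nonneg_left h2 hpos.le
    by_contra! hc
    nlinarith
  have hs : s = 2 := le_antisymm hs2 hs1
  subst hs
  exact ⟨rfl, le_antisymm (by nlinarith) h1⟩

/-- Far from the origin the quotient stays below a smaller bound. -/
theorem add_mul_div_le_of_four_le {a b s N : ℝ} (ha : 0 < a) (hb : 0 < b)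
    (hs : 4 ≤ s) (h2 : s - 1 ≤ N) : (a + b * s) / N ≤ (a + 4 * b) / 3 := by
  rw [div_le_div_iff₀ (by linarith) (by norm_num)]
  nlinarith [mul_le_mul_of_nonneg_left h2 (by positivity : 0 ≤ a + 4 * b)]

theorem nonempty_of_sSup_ne_zero {s : Set ℝ} (h : sSup s ≠ 0) : s.Nonempty :=
  Set.nonempty_iff_ne_empty.mpr fun he => h (by rw [he, Real.sSup_empty])

section NormedSpace

variable {X : Type*} [NormedAddCommGroup X] [NormedSpace ℝ X]

theorem sub_one_le_norm_add_smul {u v : X} (hu : ‖u‖ = 1) (hv : ‖v‖ = 1) (s : ℝ) :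
    s - 1 ≤ ‖u + s • v‖ := by
  have h := norm_sub_le (u + s • v) u
  rw [add_sub_cancel_left, norm_smul, hv, hu, Real.norm_eq_abs] at h
  linarith [le_abs_self s]

/-- The sphere contains a segment of length two iff there are Birkhoff-James orthogonal unit
vectors `u`, `v` with `‖u + 2 • v‖ = 1`. -/
theorem exists_unit_segment_iff_exists_birkhoffJames :
    (∃ u v : X, ‖u‖ = 1 ∧ ‖v‖ = 1 ∧
      (∀ t : ℝ, t ∈ Set.Ioo (0 : ℝ) 1 → ‖t • u + (1 - t) • v‖ = 1) ∧ ‖u - v‖ = 2) ↔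
    ∃ u v : X, ‖u‖ = 1 ∧ ‖v‖ = 1 ∧ (∀ c : ℝ, ‖u‖ ≤ ‖u + c • v‖) ∧ ‖u + (2 : ℝ) • v‖ = 1 := by
  constructor
  · rintro ⟨u, w, hu, hw, hseg, huw⟩
    -- The midpoint is a minimum of the norm on the whole line, by convexity.
    have hmid : ‖(1 / 2 : ℝ) • u + (1 / 2 : ℝ) • w‖ = 1 := by
      have := hseg (1 / 2) (by norm_num)
      norm_num at this ⊢
      exact this
    refine ⟨u, (1 / 2 : ℝ) • (w - u), hu, ?_, fun c => ?_, ?_⟩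
    · rw [norm_smul, norm_sub_rev, huw]; norm_num
    · have hconv : ConvexOn ℝ Set.univ (fun c : ℝ => ‖u + c • ((1 / 2 : ℝ) • (w - u))‖) := by
        refine ⟨convex_univ, fun x _ y _ a b ha hb hab => ?_⟩
        have : u + (a • x + b • y) • ((1 / 2 : ℝ) • (w - u)) =
            a • (u + x • ((1 / 2 : ℝ) • (w - u))) + b • (u + y • ((1 / 2 : ℝ) • (w - u))) := by
          obtain rfl : a = 1 - b := by linarith
          simp only [smul_eq_mul]
          module
        simp only [this]
        refine (norm_add_le _ _).trans_eq ?_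
        rw [norm_smul_of_nonneg ha, norm_smul_of_nonneg hb]
        rfl
      have hmin : IsMinOn (fun c : ℝ => ‖u + c • ((1 / 2 : ℝ) • (w - u))‖) Set.univ 1 := by
        refine IsMinOn.of_isLocalMinOn_of_convexOn (Set.mem_univ _) ?_ hconv
        rw [IsLocalMinOn, nhdsWithin_univ]
        filter_upwards [Ioo_mem_nhds (a := 0) (b := 2) (by norm_num : (0 : ℝ) < 1)
          (by norm_num)] with x hx
        have hval : ∀ x ∈ Set.Ioo (0 : ℝ) 2, ‖u + x • ((1 / 2 : ℝ) • (w - u))‖ = 1 := by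
          intro x hx
          refine Eq.trans ?_ (hseg (1 - x / 2) ⟨by linarith [hx.2], by linarith [hx.1]⟩)
          congr 1
          module
        rw [hval x hx, hval 1 (by norm_num)]
      have h1 := hmin (Set.mem_univ c)
      rw [hu]
      refine le_trans (hmid.symm.trans ?_).le h1
      congr 1
      module
    · refine Eq.trans ?_ hw
      congr 1
      module
  · rintro ⟨u, v, hu, hv, hort, h2⟩
    refine ⟨u, u + (2 : ℝ) • v, hu, h2, fun t ht => le_antisymm ?_ ?_, ?_⟩
    · refine (norm_add_le _ _).trans_eq ?_
      rw [norm_smul_of_nonneg ht.1.le, norm_smul_of_nonneg (by linarith [ht.2]), hu, h2]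
      ring
    · refine hu.symm.le.trans ?_
      refine (hort (2 * (1 - t))).trans_eq ?_
      congr 1
      module
    · rw [sub_add_cancel_left, norm_neg, norm_smul, hv]
      norm_num

/-- The set of Birkhoff-James orthogonal pairs of unit vectors, together with a coefficient in
`[0, 4]`, is compact. -/
theorem isCompact_birkhoffJames_pairs [FiniteDimensional ℝ X] :
    IsCompact {p : ℝ × X × X | p.1 ∈ Set.Icc (0 : ℝ) 4 ∧ ‖p.2.1‖ = 1 ∧ ‖p.2.2‖ = 1 ∧
      ∀ c : ℝ, ‖p.2.1‖ ≤ ‖p.2.1 + c • p.2.2‖} := by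
  have : ProperSpace X := FiniteDimensional.proper_real X
  have hK := (isCompact_Icc (a := (0 : ℝ)) (b := 4)).prod
    ((isCompact_sphere (0 : X) 1).prod (isCompact_sphere (0 : X) 1))
  have hC : IsClosed {p : ℝ × X × X | ∀ c : ℝ, ‖p.2.1‖ ≤ ‖p.2.1 + c • p.2.2‖} := by
    rw [Set.ofPred_forall]
    exact isClosed_iInter fun c => isClosed_le (by fun_prop) (by fun_prop)
  convert hK.inter_right hC using 1
  ext p
  simp [and_assoc]

end NormedSpace

/-- The rectangular modulus attains its upper bound `max (λ + 2) (1 + 2λ)` iff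
the unit sphere contains a straight line segment of length 2. -/
theorem stmt_6 {X : Type*} [NormedAddCommGroup X] [NormedSpace ℝ X]
    [FiniteDimensional ℝ X] (hdim : 2 ≤ Module.finrank ℝ X)
    (lam : ℝ) (hlam : 0 < lam) :
    sSup { r : ℝ | ∃ t : ℝ, ∃ u v : X, 0 < t ∧ ‖u‖ = 1 ∧ ‖v‖ = 1 ∧
        (∀ c : ℝ, ‖u‖ ≤ ‖u + c • v‖) ∧
        r = max ((lam ^ 2 + t) / ‖lam • u + t • v‖)
              ((1 + lam ^ 2 * t) / ‖u + (lam * t) • v‖) } =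
      max (lam + 2) (1 + 2 * lam) ↔
      ∃ u v : X, ‖u‖ = 1 ∧ ‖v‖ = 1 ∧
        (∀ t : ℝ, t ∈ Set.Ioo (0 : ℝ) 1 → ‖t • u + (1 - t) • v‖ = 1) ∧
        ‖u - v‖ = 2 := by
  rw [exists_unit_segment_iff_exists_birkhoffJames]
  set M := max (lam + 2) (1 + 2 * lam)
  -- After rescaling `t`, both quotients have the same denominator `‖u + s • v‖`.
  set g : ℝ × X × X → ℝ := fun p => max ((lam + 1 * p.1) / ‖p.2.1 + p.1 • p.2.2‖)
    ((1 + lam * p.1) / ‖p.2.1 + p.1 • p.2.2‖)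
  have hub : ∀ (s : ℝ) (u v : X), ‖u‖ = 1 → ‖v‖ = 1 → (∀ c : ℝ, ‖u‖ ≤ ‖u + c • v‖) →
      g (s, u, v) ≤ M := by
    intro s u v hu hv hort
    have h1 := hu ▸ hort s
    have h2 := sub_one_le_norm_add_smul hu hv s
    refine max_le_max ((add_mul_div_le_add_two_mul hlam one_pos h1 h2).trans_eq (by ring))
      (add_mul_div_le_add_two_mul one_pos hlam h1 h2)
  have hfirst : ∀ (s : ℝ) (u v : X),
      (lam ^ 2 + lam * s) / ‖lam • u + (lam * s) • v‖ = (lam + 1 * s) / ‖u + s • v‖ := by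
    intro s u v
    rw [show lam • u + (lam * s) • v = lam • (u + s • v) by module,
      norm_smul_of_nonneg hlam.le, show lam ^ 2 + lam * s = lam * (lam + 1 * s) by ring,
      mul_div_mul_left _ _ hlam.ne']
  have hsecond : ∀ (s : ℝ) (u v : X), (1 + lam ^ 2 * (s / lam)) / ‖u + (lam * (s / lam)) • v‖ =
      (1 + lam * s) / ‖u + s • v‖ := by
    intro s u v
    rw [mul_div_cancel₀ s hlam.ne', show lam ^ 2 * (s / lam) = lam * s by field_simp]
  have hle : ∀ B : ℝ, (∀ (s : ℝ) (u v : X), 0 < s → ‖u‖ = 1 → ‖v‖ = 1 →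
      (∀ c : ℝ, ‖u‖ ≤ ‖u + c • v‖) → g (s, u, v) ≤ B) →
      ∀ (t : ℝ) (u v : X), 0 < t → ‖u‖ = 1 → ‖v‖ = 1 → (∀ c : ℝ, ‖u‖ ≤ ‖u + c • v‖) →
      max ((lam ^ 2 + t) / ‖lam • u + t • v‖)
        ((1 + lam ^ 2 * t) / ‖u + (lam * t) • v‖) ≤ B := by
    intro B hB t u v ht hu hv hort
    have e1 := hfirst (t / lam) u v
    have e2 := hsecond (lam * t) u v
    rw [mul_div_cancel₀ t hlam.ne'] at e1
    rw [mul_div_cancel_left₀ t hlam.ne'] at e2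
    rw [e1, e2]
    exact max_le ((le_max_left _ _).trans (hB (t / lam) u v (by positivity) hu hv hort))
      ((le_max_right _ _).trans (hB (lam * t) u v (by positivity) hu hv hort))
  have hM0 : 0 < M := lt_max_of_lt_left (by linarith)
  constructor
  · intro h
    obtain ⟨-, t₀, u₀, v₀, ht₀, hu₀, hv₀, hort₀, -⟩ :=
      nonempty_of_sSup_ne_zero (h.trans_ne hM0.ne')
    have hcont : ContinuousOn g {p : ℝ × X × X | p.1 ∈ Set.Icc (0 : ℝ) 4 ∧ ‖p.2.1‖ = 1 ∧
        ‖p.2.2‖ = 1 ∧ ∀ c : ℝ, ‖p.2.1‖ ≤ ‖p.2.1 + c • p.2.2‖} := by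
      have hne : ∀ p ∈ {p : ℝ × X × X | p.1 ∈ Set.Icc (0 : ℝ) 4 ∧ ‖p.2.1‖ = 1 ∧
          ‖p.2.2‖ = 1 ∧ ∀ c : ℝ, ‖p.2.1‖ ≤ ‖p.2.1 + c • p.2.2‖},
          ‖p.2.1 + p.1 • p.2.2‖ ≠ 0 := by
        rintro p ⟨-, hu, -, hort⟩
        have := hort p.1
        rw [hu] at this
        exact (one_pos.trans_le this).ne'
      refine ContinuousOn.sup ?_ ?_ <;>
        exact ContinuousOn.div (by fun_prop) (by fun_prop) hne
    obtain ⟨⟨s, u, v⟩, ⟨-, hu, hv, hort⟩, hmax⟩ := isCompact_birkhoffJames_pairs.exists_isMaxOn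
      ⟨(0, u₀, v₀), by norm_num, hu₀, hv₀, hort₀⟩ hcont
    refine ⟨u, v, hu, hv, hort, ?_⟩
    dsimp only at hu hv hort
    have hM' : max ((lam + 4 * 1) / 3) ((1 + 4 * lam) / 3) < M :=
      max_lt_max (by linarith) (by linarith)
    have hge : M ≤ g (s, u, v) := by
      by_contra! hlt
      refine (max_lt hlt hM').not_ge (h.symm.le.trans (csSup_le ⟨_, t₀, u₀, v₀, ht₀, hu₀, hv₀,
        hort₀, rfl⟩ ?_))
      rintro r ⟨t, u', v', ht, hu', hv', hort', rfl⟩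
      refine hle _ (fun s' x y hs' hx hy hxy => ?_) t u' v' ht hu' hv' hort'
      rcases le_total s' 4 with h4 | h4
      · exact le_max_of_le_left
          (hmax (show (s', x, y) ∈ {p : ℝ × X × X | p.1 ∈ Set.Icc (0 : ℝ) 4 ∧ ‖p.2.1‖ = 1 ∧
            ‖p.2.2‖ = 1 ∧ ∀ c : ℝ, ‖p.2.1‖ ≤ ‖p.2.1 + c • p.2.2‖} from ⟨⟨hs'.le, h4⟩, hx, hy, hxy⟩))
      · have h2 := sub_one_le_norm_add_smul hx hy s'
        exact le_max_of_le_right (max_le_max (add_mul_div_le_of_four_le hlam one_pos h4 h2)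
          (add_mul_div_le_of_four_le one_pos hlam h4 h2))
    have h1 := hu ▸ hort s
    have h2 := sub_one_le_norm_add_smul hu hv s
    obtain ⟨rfl, h3⟩ : s = 2 ∧ ‖u + s • v‖ = 1 := by
      rcases le_max_iff.mp hge with hc | hc
      · exact eq_two_and_eq_one_of_add_two_mul_le hlam one_pos h1 h2
          (le_trans (le_trans (by linarith) (le_max_left _ _)) hc)
      · exact eq_two_and_eq_one_of_add_two_mul_le one_pos hlam h1 h2
          ((le_max_right _ _).trans hc)
    exact h3
  · rintro ⟨u, v, hu, hv, hort, h2⟩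
    have hupper : ∀ r ∈ { r : ℝ | ∃ t : ℝ, ∃ u v : X, 0 < t ∧ ‖u‖ = 1 ∧ ‖v‖ = 1 ∧
        (∀ c : ℝ, ‖u‖ ≤ ‖u + c • v‖) ∧
        r = max ((lam ^ 2 + t) / ‖lam • u + t • v‖)
              ((1 + lam ^ 2 * t) / ‖u + (lam * t) • v‖) }, r ≤ M := by
      rintro r ⟨t, x, y, ht, hx, hy, hxy, rfl⟩
      exact hle M (fun s x y _ => hub s x y) t x y ht hx hy hxy
    have e1 := hfirst 2 u v
    have e2 := hsecond 2 u v
    rw [h2, div_one] at e1 e2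
    refine le_antisymm (csSup_le ⟨_, 1, u, v, one_pos, hu, hv, hort, rfl⟩ hupper) (max_le ?_ ?_)
    · refine le_trans ?_ (le_csSup ⟨M, hupper⟩
        ⟨lam * 2, u, v, by positivity, hu, hv, hort, rfl⟩)
      exact le_max_of_le_left (by linarith)
    · refine le_trans ?_ (le_csSup ⟨M, hupper⟩
        ⟨2 / lam, u, v, by positivity, hu, hv, hort, rfl⟩)
      exact le_max_of_le_right (by linarith)
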